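/- arXiv:2504.02650 — 2 statements merged into one kernel-verified Lean document; each statement's English description precedes it below -/
import Mathlib

section
/- Let Π and Π' be two Π4°-free pre-rotation systems on the same 5-element set. If Π' is neither equal to Π nor to the reflection of Π, then Π and Π' have distinct sets of crossing pairs of disjoint edges. -/
/-!
Common definitions for pre-rotation systems of simple drawings of complete graphs.

A cyclic permutation of a finite set `S` is modelled by an `Equiv.Perm` that fixes
everything outside `S` and has all of `S` in one cycle.  The ternary relation
`CycOrd f S b c d` expresses that, traversing the cycle of `f` starting at `b`,
one meets `c` strictly before `d` (within one full period).  For sets with at least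
three elements, a cyclic permutation is uniquely determined by this ternary relation,
so equality of induced subconfigurations is expressed via `CycOrd`.
-/

section Defs

variable {α : Type*}

/-- `f` is a cyclic permutation of the finite set `S`: it fixes every point outside `S`
and all elements of `S` lie on one common cycle of `f`. -/
def IsCyclicPermOn (f : Equiv.Perm α) (S : Finset α) : Prop :=
  (∀ a ∉ S, f a = a) ∧ ∀ a ∈ S, ∀ b ∈ S, ∃ k : ℕ, (⇑f)^[k] a = b

/-- `b, c, d` appear in this cyclic order in the cyclic permutation `f` of the set `S`:
traversing the cycle starting at `b`, one meets `c` strictly before `d`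
(both within one full period). -/
def CycOrd (f : Equiv.Perm α) (S : Finset α) (b c d : α) : Prop :=
  ∃ i j : ℕ, 0 < i ∧ i < j ∧ j < S.card ∧ (⇑f)^[i] b = c ∧ (⇑f)^[j] b = d

/-- A pre-rotation system on the finite vertex set `α`: every vertex `v` is assigned a
cyclic permutation of the remaining vertices. -/
structure PreRotSys (α : Type*) [Fintype α] [DecidableEq α] where
  rot : α → Equiv.Perm α
  cyc : ∀ v, IsCyclicPermOn (rot v) (Finset.univ.erase v)

variable [Fintype α] [DecidableEq α]

/-- `b, c, d` appear in this cyclic (counterclockwise) order in the rotation of `v`. -/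
def rotOrd (P : PreRotSys α) (v b c d : α) : Prop :=
  CycOrd (P.rot v) (Finset.univ.erase v) b c d

/-- `P'` is the reflection of `P`: every cyclic permutation is reversed. -/
def IsReflection (P P' : PreRotSys α) : Prop :=
  ∀ v, P'.rot v = (P.rot v)⁻¹

/-- `P` is Π4°-free: no induced subconfiguration on four elements is (up to relabelling,
possibly followed by reflection) the obstruction Π4° with
π_a=(b,c,d), π_b=(a,c,d), π_c=(a,b,d), π_d=(a,c,b). -/
def Pi4Free (P : PreRotSys α) : Prop :=
  ∀ a b c d : α, a ≠ b → a ≠ c → a ≠ d → b ≠ c → b ≠ d → c ≠ d →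
    ¬ (rotOrd P a b c d ∧ rotOrd P b a c d ∧ rotOrd P c a b d ∧ rotOrd P d a c b) ∧
    ¬ (rotOrd P a b d c ∧ rotOrd P b a d c ∧ rotOrd P c a d b ∧ rotOrd P d a b c)

/-- The disjoint edges `{p, r}` and `{q, s}` cross: the induced subconfiguration on
`{p, q, r, s}` is, possibly after reversing all four cyclic permutations, equal to
π_p=(q,r,s), π_q=(p,r,s), π_r=(p,q,s), π_s=(p,q,r). -/
def Crosses (P : PreRotSys α) (p q r s : α) : Prop :=
  (p ≠ q ∧ p ≠ r ∧ p ≠ s ∧ q ≠ r ∧ q ≠ s ∧ r ≠ s) ∧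
  ((rotOrd P p q r s ∧ rotOrd P q p r s ∧ rotOrd P r p q s ∧ rotOrd P s p q r) ∨
   (rotOrd P p q s r ∧ rotOrd P q p s r ∧ rotOrd P r p s q ∧ rotOrd P s p r q))

/-- Two pre-rotation systems are isomorphic: one is obtained from the other by
relabelling the elements, possibly followed by reflection. -/
def IsoPRS (P P' : PreRotSys α) : Prop :=
  ∃ e : Equiv.Perm α,
    (∀ v, P'.rot (e v) = e * P.rot v * e⁻¹) ∨
    (∀ v, P'.rot (e v) = (e * P.rot v * e⁻¹)⁻¹)

/-- The induced subconfigurations `P|_I` and `P'|_I` are equal (expressed via the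
ternary cyclic-order relations, which determine cyclic permutations of sets with
at least three elements). -/
def RestrictEq (P P' : PreRotSys α) (I : Finset α) : Prop :=
  ∀ v ∈ I, ∀ b ∈ I, ∀ c ∈ I, ∀ d ∈ I, (rotOrd P v b c d ↔ rotOrd P' v b c d)

/-- The induced subconfiguration `P'|_I` is the reflection of `P|_I` (expressed via
the ternary cyclic-order relations). -/
def RestrictReflEq (P P' : PreRotSys α) (I : Finset α) : Prop :=
  ∀ v ∈ I, ∀ b ∈ I, ∀ c ∈ I, ∀ d ∈ I, (rotOrd P' v b c d ↔ rotOrd P v b d c)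

/-- The `k` distinct elements `u 0, …, u (k-1)` form a perfect twisted configuration `T_k`:
for all `a < b < c < d`, the disjoint edges `{u a, u d}` and `{u b, u c}` cross, and no
other pair of disjoint edges among them crosses. -/
def TwistedTuple (P : PreRotSys α) {k : ℕ} (u : Fin k → α) : Prop :=
  ∀ a b c d : Fin k, a < b → b < c → c < d →
    Crosses P (u a) (u b) (u d) (u c) ∧
    ¬ Crosses P (u a) (u c) (u b) (u d) ∧
    ¬ Crosses P (u a) (u b) (u c) (u d)

/-- `P` is generalized twisted: it is Π4°-free and every induced subconfiguration on
five elements is of twisted type (i.e. can be labelled so as to form a `T_5`). -/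
def GenTwisted (P : PreRotSys α) : Prop :=
  Pi4Free P ∧
    ∀ w : Fin 5 → α, Function.Injective w →
      ∃ e : Equiv.Perm (Fin 5), TwistedTuple P (fun x => w (e x))

/-- `P` contains `T_k`, the perfect twisted drawing on `k` vertices. -/
def ContainsT (P : PreRotSys α) (k : ℕ) : Prop :=
  ∃ u : Fin k → α, Function.Injective u ∧ TwistedTuple P u

end Defs

section FourTuples

variable {α : Type*} {R : α → α → α → α → Prop} {x₀ x₁ x₂ x₃ y₀ y₁ y₂ y₃ : α}

theorem nodup_four_iff {p q r s : α} :
    [p, q, r, s].Nodup ↔ p ≠ q ∧ p ≠ r ∧ p ≠ s ∧ q ≠ r ∧ q ≠ s ∧ r ≠ s := by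
  grind

/-- A relation on quadruples of distinct elements that is invariant under permuting the
entries and under replacing one entry by an unused element is constant. -/
theorem nodup_four_iff_of_invariant
    (swap : ∀ {p q r s : α}, [p, q, r, s].Nodup → (R p q r s ↔ R q p r s))
    (rotate : ∀ {p q r s : α}, [p, q, r, s].Nodup → (R p q r s ↔ R p r s q))
    (swap_last : ∀ {p q r s : α}, [p, q, r, s].Nodup → (R p q r s ↔ R p q s r))
    (replace : ∀ {p p' q r s : α}, [p, p', q, r, s].Nodup → (R p q r s ↔ R p' q r s))
    (hx : [x₀, x₁, x₂, x₃].Nodup) (hy : [y₀, y₁, y₂, y₃].Nodup) :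
    R x₀ x₁ x₂ x₃ ↔ R y₀ y₁ y₂ y₃ := by
  have nodup_swap {p q r s : α} (h : [p, q, r, s].Nodup) : [q, p, r, s].Nodup := by
    clear * - h; grind
  have nodup_rotate {p q r s : α} (h : [p, q, r, s].Nodup) : [p, r, s, q].Nodup := by
    clear * - h; grind
  have nodup_swap_last {p q r s : α} (h : [p, q, r, s].Nodup) : [p, q, s, r].Nodup := by
    clear * - h; grind
  have replace_head {p p' q r s : α} (h : [p, q, r, s].Nodup) (h' : [p', q, r, s].Nodup) :
      R p q r s ↔ R p' q r s := by
    by_cases hp : p = p'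
    · rw [hp]
    · exact replace (by clear * - h h' hp; grind)
  have replace_second {p q q' r s : α} (h : [p, q, r, s].Nodup) (h' : [p, q', r, s].Nodup) :
      R p q r s ↔ R p q' r s := by
    rw [swap h, swap h', replace_head (nodup_swap h) (nodup_swap h')]
  have replace_last {p q r s s' : α} (h : [p, q, r, s].Nodup) (h' : [p, q, r, s'].Nodup) :
      R p q r s ↔ R p q r s' := by
    rw [rotate h, rotate (nodup_rotate h), rotate h', rotate (nodup_rotate h')]
    exact replace_second (nodup_rotate (nodup_rotate h)) (nodup_rotate (nodup_rotate h'))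
  have first {p q r s : α} (h : [p, q, r, s].Nodup) (w : α) :
      ∃ a b c, [w, a, b, c].Nodup ∧ (R p q r s ↔ R w a b c) := by
    by_cases hq : w = q
    · exact ⟨p, r, s, hq ▸ nodup_swap h, by rw [swap h, hq]⟩
    by_cases hr : w = r
    · have h1 := nodup_rotate h
      exact ⟨p, s, q, hr ▸ nodup_swap h1, by rw [rotate h, swap h1, hr]⟩
    by_cases hs : w = s
    · have h1 := nodup_rotate (nodup_rotate h)
      exact ⟨p, q, r, hs ▸ nodup_swap h1,
        by rw [rotate h, rotate (nodup_rotate h), swap h1, hs]⟩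
    · have h1 : [w, q, r, s].Nodup := by clear * - h hq hr hs; grind
      exact ⟨q, r, s, h1, replace_head h h1⟩
  have second {p q r s : α} (h : [p, q, r, s].Nodup) {w : α} (hp : w ≠ p) :
      ∃ a b, [p, w, a, b].Nodup ∧ (R p q r s ↔ R p w a b) := by
    have h1 := nodup_rotate h
    by_cases hr : w = r
    · exact ⟨s, q, hr ▸ h1, by rw [rotate h, hr]⟩
    by_cases hs : w = s
    · exact ⟨q, r, hs ▸ nodup_rotate h1, by rw [rotate h, rotate h1, hs]⟩
    · have h2 : [p, w, r, s].Nodup := by clear * - h hp hr hs; grind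
      exact ⟨r, s, h2, replace_second h h2⟩
  have third {p q r s : α} (h : [p, q, r, s].Nodup) {w : α} (hp : w ≠ p) (hq : w ≠ q) :
      ∃ a, [p, q, w, a].Nodup ∧ (R p q r s ↔ R p q w a) := by
    by_cases hr : w = r
    · exact ⟨s, hr ▸ h, by rw [hr]⟩
    · have h1 : [p, q, r, w].Nodup := by clear * - h hp hq hr; grind
      exact ⟨r, nodup_swap_last h1, by rw [replace_last h h1, swap_last h1]⟩
  obtain ⟨h01, h02, -, h12, -⟩ := nodup_four_iff.1 hy
  obtain ⟨a, b, c, h1, e1⟩ := first hx y₀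
  obtain ⟨d, e, h2, e2⟩ := second h1 h01.symm
  obtain ⟨f, h3, e3⟩ := third h2 h02.symm h12.symm
  rw [e1, e2, e3, replace_last h3 hy]

end FourTuples

section CyclicPerm

variable {α : Type*} {f g : Equiv.Perm α} {S : Finset α} {b c d e : α}

theorem IsCyclicPermOn.isCycleOn (hf : IsCyclicPermOn f S) : f.IsCycleOn S := by
  have hmaps : Set.MapsTo f S S := by
    intro a ha
    by_contra h
    have h1 : f a = a := f.injective (hf.1 (f a) h)
    exact h (h1.symm ▸ ha)
  refine ⟨⟨hmaps, f.injective.injOn, ?_⟩, ?_⟩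
  · exact (Finset.surjOn_of_injOn_of_card_le f hmaps f.injective.injOn le_rfl)
  · intro a ha b hb
    obtain ⟨k, hk⟩ := hf.2 a ha b hb
    exact ⟨k, by simpa [← Equiv.Perm.iterate_eq_pow] using hk⟩

/-- On a four-element set, a cyclic permutation lists the set as `b, f b, f (f b), f (f (f b))`. -/
theorem IsCyclicPermOn.orbit_of_card_eq_four (hf : IsCyclicPermOn f S) (hS : S.card = 4)
    (hb : b ∈ S) :
    f (f (f (f b))) = b ∧ f b ≠ b ∧ f (f b) ≠ b ∧ f (f (f b)) ≠ b ∧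
      ∀ x ∈ S, x = b ∨ x = f b ∨ x = f (f b) ∨ x = f (f (f b)) := by
  have hc := hf.isCycleOn
  have key (n : ℕ) : (f ^ n) b = b ↔ 4 ∣ n := hS ▸ hc.pow_apply_eq hb
  refine ⟨(key 4).2 (by norm_num), fun h => ?_, fun h => ?_, fun h => ?_, fun x hx => ?_⟩
  · exact absurd ((key 1).1 h) (by norm_num)
  · exact absurd ((key 2).1 h) (by norm_num)
  · exact absurd ((key 3).1 h) (by norm_num)
  · obtain ⟨n, hn, rfl⟩ := hc.exists_pow_eq hb hx
    rw [hS] at hn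
    interval_cases n
    · exact .inl rfl
    · exact .inr (.inl rfl)
    · exact .inr (.inr (.inl rfl))
    · exact .inr (.inr (.inr rfl))

theorem cycOrd_iff_of_card_eq_four (hS : S.card = 4) :
    CycOrd f S b c d ↔
      (f b = c ∧ f (f b) = d) ∨ (f b = c ∧ f (f (f b)) = d) ∨
        (f (f b) = c ∧ f (f (f b)) = d) := by
  constructor
  · rintro ⟨i, j, hi, hij, hj, h⟩
    rw [hS] at hj
    interval_cases j <;> interval_cases i
    · exact .inl h
    · exact .inr (.inl h)
    · exact .inr (.inr h)
  · rintro (h | h | h)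
    · exact ⟨1, 2, by omega, by omega, by omega, h⟩
    · exact ⟨1, 3, by omega, by omega, by omega, h⟩
    · exact ⟨2, 3, by omega, by omega, by omega, h⟩

theorem IsCyclicPermOn.cycOrd_swap (hf : IsCyclicPermOn f S) (hS : S.card = 4)
    (hb : b ∈ S) (hc : c ∈ S) (hd : d ∈ S) (hbc : b ≠ c) (hbd : b ≠ d) (hcd : c ≠ d) :
    CycOrd f S b d c ↔ ¬ CycOrd f S b c d := by
  obtain ⟨h4, h1, h2, h3, hx⟩ := hf.orbit_of_card_eq_four hS hb
  have hc' := hx c hc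
  have hd' := hx d hd
  simp only [cycOrd_iff_of_card_eq_four hS]
  have i1 := f.injective.ne h1
  have i2 := f.injective.ne h2
  have i3 := f.injective.ne i1
  grind

theorem IsCyclicPermOn.cycOrd_rotate (hf : IsCyclicPermOn f S) (hS : S.card = 4)
    (hb : b ∈ S) (hc : c ∈ S) (hd : d ∈ S) (hbc : b ≠ c) (hbd : b ≠ d) (hcd : c ≠ d) :
    CycOrd f S b c d ↔ CycOrd f S c d b := by
  obtain ⟨h4, h1, h2, h3, hx⟩ := hf.orbit_of_card_eq_four hS hb
  have hc' := hx c hc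
  have hd' := hx d hd
  simp only [cycOrd_iff_of_card_eq_four hS]
  have i1 := f.injective.ne h1
  have i2 := f.injective.ne h2
  have i3 := f.injective.ne i1
  grind

/-- Among the four triples of a cyclically ordered four-element set, listed in a fixed
linear order, an even number is positively oriented. -/
theorem IsCyclicPermOn.cycOrd_parity (hf : IsCyclicPermOn f S) (hS : S.card = 4)
    (hb : b ∈ S) (hc : c ∈ S) (hd : d ∈ S) (he : e ∈ S)
    (hbc : b ≠ c) (hbd : b ≠ d) (hbe : b ≠ e) (hcd : c ≠ d) (hce : c ≠ e) (hde : d ≠ e) :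
    ((CycOrd f S b c d ↔ CycOrd f S b c e) ↔ (CycOrd f S b d e ↔ CycOrd f S c d e)) := by
  obtain ⟨h4, h1, h2, h3, hx⟩ := hf.orbit_of_card_eq_four hS hb
  have hc' := hx c hc
  have hd' := hx d hd
  have he' := hx e he
  simp only [cycOrd_iff_of_card_eq_four hS]
  have i1 := f.injective.ne h1
  have i2 := f.injective.ne h2
  have i3 := f.injective.ne i1
  grind

theorem IsCyclicPermOn.not_cycOrd_apply (hf : IsCyclicPermOn f S) (hS : S.card = 4)
    (hb : b ∈ S) : ¬ CycOrd f S b c (f b) := by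
  obtain ⟨-, h1, h2, -⟩ := hf.orbit_of_card_eq_four hS hb
  have i1 := f.injective.ne h1
  have i2 := f.injective.ne h2
  simp only [cycOrd_iff_of_card_eq_four hS]
  grind

theorem IsCyclicPermOn.eq_of_cycOrd_iff (hf : IsCyclicPermOn f S) (hg : IsCyclicPermOn g S)
    (hS : S.card = 4)
    (h : ∀ b ∈ S, ∀ c ∈ S, ∀ d ∈ S, b ≠ c → b ≠ d → c ≠ d →
      (CycOrd f S b c d ↔ CycOrd g S b c d)) : g = f := by
  ext b
  by_cases hb : b ∈ S
  · by_contra hne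
    obtain ⟨-, h1, -, -, hx⟩ := hf.orbit_of_card_eq_four hS hb
    have hfb := hf.isCycleOn.1.mapsTo hb
    have hgb := hg.isCycleOn.1.mapsTo hb
    have hg1 := (hg.orbit_of_card_eq_four hS hb).2.1
    refine hg.not_cycOrd_apply hS hb
      ((h b hb (f b) hfb (g b) hgb h1.symm hg1.symm (Ne.symm hne)).1 ?_)
    rw [cycOrd_iff_of_card_eq_four hS]
    grind
  · rw [hf.1 b hb, hg.1 b hb]

theorem IsCyclicPermOn.eq_inv_of_cycOrd_iff (hf : IsCyclicPermOn f S)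
    (hg : IsCyclicPermOn g S) (hS : S.card = 4)
    (h : ∀ b ∈ S, ∀ c ∈ S, ∀ d ∈ S, b ≠ c → b ≠ d → c ≠ d →
      (CycOrd f S b c d ↔ CycOrd g S b d c)) : g = f⁻¹ := by
  ext b
  rw [Equiv.Perm.eq_inv_iff_eq]
  by_cases hb : b ∈ S
  · obtain ⟨h4, -, -, h3, hx⟩ := hf.orbit_of_card_eq_four hS hb
    have hmaps {a : α} (ha : a ∈ S) : f a ∈ S := hf.isCycleOn.1.mapsTo ha
    have hgb := hg.isCycleOn.1.mapsTo hb
    have hg1 := (hg.orbit_of_card_eq_four hS hb).2.1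
    by_contra hne
    have hne' : g b ≠ f (f (f b)) := fun heq => hne (by rw [heq, h4])
    refine hg.not_cycOrd_apply hS hb
      ((h b hb (g b) hgb _ (hmaps (hmaps (hmaps hb))) hg1.symm h3.symm hne').1 ?_)
    rw [cycOrd_iff_of_card_eq_four hS]
    grind
  · rw [hg.1 b hb, hf.1 b hb]

end CyclicPerm

section FiveElements

variable {α : Type*} [Fintype α] [DecidableEq α] {P P' : PreRotSys α} {v b c d e p q r s : α}

theorem card_univ_erase_eq_four (hcard : Fintype.card α = 5) (v : α) :
    (Finset.univ.erase v).card = 4 := by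
  simp [Finset.card_erase_of_mem, hcard]

theorem rotOrd_swap (hcard : Fintype.card α = 5) (P : PreRotSys α) (h : [v, b, c, d].Nodup) :
    rotOrd P v b d c ↔ ¬ rotOrd P v b c d := by
  simp only [List.nodup_cons, List.mem_cons, List.not_mem_nil, or_false, not_or] at h
  apply (P.cyc v).cycOrd_swap (card_univ_erase_eq_four hcard v) <;> grind

theorem rotOrd_rotate (hcard : Fintype.card α = 5) (P : PreRotSys α) (h : [v, b, c, d].Nodup) :
    rotOrd P v b c d ↔ rotOrd P v c d b := by
  simp only [List.nodup_cons, List.mem_cons, List.not_mem_nil, or_false, not_or] at h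
  apply (P.cyc v).cycOrd_rotate (card_univ_erase_eq_four hcard v) <;> grind

theorem rotOrd_parity (hcard : Fintype.card α = 5) (P : PreRotSys α)
    (h : [v, b, c, d, e].Nodup) :
    ((rotOrd P v b c d ↔ rotOrd P v b c e) ↔ (rotOrd P v b d e ↔ rotOrd P v c d e)) := by
  simp only [List.nodup_cons, List.mem_cons, List.not_mem_nil, or_false, not_or] at h
  apply (P.cyc v).cycOrd_parity (card_univ_erase_eq_four hcard v) <;> grind

/-- `P` and `P'` orient the triple `b, c, d` around `v` in the same way. -/
def SameOrientation (P P' : PreRotSys α) (v b c d : α) : Prop :=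
  rotOrd P v b c d ↔ rotOrd P' v b c d

theorem sameOrientation_swap (hcard : Fintype.card α = 5) (h : [v, b, c, d].Nodup) :
    SameOrientation P P' v b d c ↔ SameOrientation P P' v b c d := by
  have h1 := rotOrd_swap hcard P h
  have h2 := rotOrd_swap hcard P' h
  unfold SameOrientation
  tauto

theorem sameOrientation_rotate (hcard : Fintype.card α = 5) (h : [v, b, c, d].Nodup) :
    SameOrientation P P' v b c d ↔ SameOrientation P P' v c d b := by
  unfold SameOrientation
  rw [rotOrd_rotate hcard P h, rotOrd_rotate hcard P' h]

theorem sameOrientation_parity (hcard : Fintype.card α = 5) (h : [v, b, c, d, e].Nodup) :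
    ((SameOrientation P P' v b c d ↔ SameOrientation P P' v b c e) ↔
      (SameOrientation P P' v b d e ↔ SameOrientation P P' v c d e)) := by
  have h1 := rotOrd_parity hcard P h
  have h2 := rotOrd_parity hcard P' h
  unfold SameOrientation
  grind

/-- Normal form of `Crosses` and `Pi4Free` on four distinct elements, in terms of
one orientation per vertex. -/
theorem crosses_normal_form (hcard : Fintype.card α = 5) (P : PreRotSys α)
    (h : [p, q, r, s].Nodup) (hP : Pi4Free P) :
    let A := rotOrd P p q r s
    let B := rotOrd P q p r s
    let C := rotOrd P r p q s
    let E := rotOrd P s p q r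
    ((A ↔ B) ↔ (C ↔ E)) ∧
    (Crosses P p q r s ↔ (A ↔ B) ∧ (B ↔ C) ∧ (C ↔ E)) ∧
    (Crosses P p r q s ↔ (A ↔ E) ∧ (B ↔ C) ∧ ¬ (A ↔ B)) ∧
    (Crosses P p q s r ↔ (A ↔ B) ∧ (C ↔ E) ∧ ¬ (A ↔ C)) := by
  intro A B C E
  simp only [List.nodup_cons, List.mem_cons, List.not_mem_nil, or_false, not_or,
    not_false_eq_true, List.nodup_nil, and_true] at h
  obtain ⟨⟨pq, pr, ps⟩, ⟨qr, qs⟩, rs⟩ := h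
  have swap {v b c d : α} (vb : v ≠ b) (vc : v ≠ c) (vd : v ≠ d) (bc : b ≠ c) (bd : b ≠ d)
      (cd : c ≠ d) : rotOrd P v b d c ↔ ¬ rotOrd P v b c d :=
    rotOrd_swap hcard P (by simp [*])
  have rotate {v b c d : α} (vb : v ≠ b) (vc : v ≠ c) (vd : v ≠ d) (bc : b ≠ c) (bd : b ≠ d)
      (cd : c ≠ d) : rotOrd P v b c d ↔ rotOrd P v c d b :=
    rotOrd_rotate hcard P (by simp [*])
  have orders {v b c d : α} (vb : v ≠ b) (vc : v ≠ c) (vd : v ≠ d) (bc : b ≠ c) (bd : b ≠ d)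
      (cd : c ≠ d) : (rotOrd P v b d c ↔ ¬ rotOrd P v b c d) ∧
        (rotOrd P v c d b ↔ rotOrd P v b c d) ∧ (rotOrd P v d b c ↔ rotOrd P v b c d) ∧
        (rotOrd P v c b d ↔ ¬ rotOrd P v b c d) ∧ (rotOrd P v d c b ↔ ¬ rotOrd P v b c d) := by
    have h1 := swap vb vc vd bc bd cd
    have h2 := rotate vb vc vd bc bd cd
    have h3 := rotate vd vb vc bd.symm cd.symm bc
    have h4 := rotate vb vd vc bd bc cd.symm
    have h5 := rotate vc vb vd bc.symm cd bd
    tauto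
  obtain ⟨a1, a2, a3, a4, a5⟩ := orders pq pr ps qr qs rs
  obtain ⟨b1, b2, b3, b4, b5⟩ := orders (Ne.symm pq) qr qs pr ps rs
  obtain ⟨c1, c2, c3, c4, c5⟩ := orders (Ne.symm pr) (Ne.symm qr) rs pq ps qs
  obtain ⟨e1, e2, e3, e4, e5⟩ := orders (Ne.symm ps) (Ne.symm qs) (Ne.symm rs) pq pr qr
  have f1 := hP p q r s pq pr ps qr qs rs
  have f2 := hP q r s p qr qs (Ne.symm pq) rs (Ne.symm pr) (Ne.symm ps)
  have f3 := hP r s p q rs (Ne.symm pr) (Ne.symm qr) (Ne.symm ps) (Ne.symm qs) pq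
  have f4 := hP s p q r (Ne.symm ps) (Ne.symm qs) (Ne.symm rs) pq pr qr
  simp only [a1, a2, a3, a4, a5, b1, b2, b3, b4, b5, c1, c2, c3, c4, c5, e1, e2, e3, e4, e5]
    at f1 f2 f3 f4
  have parity : (A ↔ B) ↔ (C ↔ E) := by
    simp only [A, B, C, E]
    clear a1 a2 a3 a4 a5 b1 b2 b3 b4 b5 c1 c2 c3 c4 c5 e1 e2 e3 e4 e5
    grind
  clear f1 f2 f3 f4
  refine ⟨parity, ?_, ?_, ?_⟩ <;>
    simp only [Crosses, a1, a2, a4, b1, c1, e1, A, B, C, E] at parity ⊢ <;>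
    clear a1 a2 a3 a4 a5 b1 b2 b3 b4 b5 c1 c2 c3 c4 c5 e1 e2 e3 e4 e5 <;>
    grind

/-- Equal crossings force `P` and `P'` to agree up to reflection on every four elements. -/
theorem sameOrientation_of_crosses_iff (hcard : Fintype.card α = 5)
    (hP : Pi4Free P) (hP' : Pi4Free P')
    (hcr : ∀ p q r s : α, Crosses P p q r s ↔ Crosses P' p q r s) (h : [p, q, r, s].Nodup) :
    SameOrientation P P' p q r s ↔ SameOrientation P P' q p r s := by
  have h1 := crosses_normal_form hcard P h hP
  have h2 := crosses_normal_form hcard P' h hP'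
  have c1 := hcr p q r s
  have c2 := hcr p r q s
  have c3 := hcr p q s r
  unfold SameOrientation
  grind

/-- The comparison of orientations is the same for any two vertices of a quadruple, and so,
by parity, the same for any two quadruples. -/
theorem sameOrientation_replace (hcard : Fintype.card α = 5)
    (hP : Pi4Free P) (hP' : Pi4Free P')
    (hcr : ∀ p q r s : α, Crosses P p q r s ↔ Crosses P' p q r s) (h : [v, b, c, d, e].Nodup) :
    SameOrientation P P' v c d e ↔ SameOrientation P P' b c d e := by
  have swap {p q r s : α} (h : [p, q, r, s].Nodup) :=
    sameOrientation_of_crosses_iff hcard hP hP' hcr h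
  have h1 := sameOrientation_parity (P := P) (P' := P') hcard h
  have h2 := sameOrientation_parity (P := P) (P' := P') (v := b) (b := v) hcard
    (c := c) (d := d) (e := e) (by grind)
  have h3 := swap (p := v) (q := b) (r := c) (s := d) (by grind)
  have h4 := swap (p := v) (q := b) (r := c) (s := e) (by grind)
  have h5 := swap (p := v) (q := b) (r := d) (s := e) (by grind)
  grind

theorem sameOrientation_const (hcard : Fintype.card α = 5)
    (hP : Pi4Free P) (hP' : Pi4Free P')
    (hcr : ∀ p q r s : α, Crosses P p q r s ↔ Crosses P' p q r s)
    (h : [v, b, c, d].Nodup) (h' : [p, q, r, s].Nodup) :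
    SameOrientation P P' v b c d ↔ SameOrientation P P' p q r s :=
  nodup_four_iff_of_invariant (sameOrientation_of_crosses_iff hcard hP hP' hcr)
    (sameOrientation_rotate hcard) (fun h => (sameOrientation_swap hcard h).symm)
    (sameOrientation_replace hcard hP hP' hcr) h h'

end FiveElements

/-- Two Π4°-free pre-rotation systems on a 5-element set which are neither
equal nor reflections of each other have distinct sets of crossing pairs of disjoint edges. -/
theorem distinct_crossings_on_five_elements
    {α : Type*} [Fintype α] [DecidableEq α] (hcard : Fintype.card α = 5)
    (P P' : PreRotSys α) (hP : Pi4Free P) (hP' : Pi4Free P')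
    (hne : ¬ ∀ v, P'.rot v = P.rot v) (hnr : ¬ IsReflection P P') :
    ¬ ∀ p q r s : α, Crosses P p q r s ↔ Crosses P' p q r s := by
  intro hcr
  have hconst {v b c d p q r s : α} (h : [v, b, c, d].Nodup) (h' : [p, q, r, s].Nodup) :=
    sameOrientation_const hcard hP hP' hcr h h'
  by_cases hall : ∃ v b c d, [v, b, c, d].Nodup ∧ SameOrientation P P' v b c d
  · obtain ⟨v, b, c, d, hnd, hsame⟩ := hall
    refine hne fun w => (P.cyc w).eq_of_cycOrd_iff (P'.cyc w) (card_univ_erase_eq_four hcard w) ?_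
    intro x hx y hy z hz hxy hxz hyz
    exact (hconst hnd (p := w) (by grind)).1 hsame
  · refine hnr fun w => (P.cyc w).eq_inv_of_cycOrd_iff (P'.cyc w)
      (card_univ_erase_eq_four hcard w) ?_
    intro x hx y hy z hz hxy hxz hyz
    have hnd : [w, x, y, z].Nodup := by grind
    have hns : ¬ SameOrientation P P' w x y z := fun hs => hall ⟨w, x, y, z, hnd, hs⟩
    have hsw := rotOrd_swap hcard P' hnd
    unfold SameOrientation at hns
    change rotOrd P w x y z ↔ rotOrd P' w x z y
    tauto
end

section
/- Let Π and Π' be pre-rotation systems on the same finite set V with |V| ≥ 5. If Π' is neither equal to Π nor to the reflection of Π, then there exists a 5-element subset I ⊆ V such that the induced subconfiguration Π'|_I is neither equal to Π|_I nor to the reflection of Π|_I. -/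
section CyclicPerm

variable {α : Type*} {f g : Equiv.Perm α} {S : Finset α}

theorem IsCyclicPermOn.iterate_mem (hf : IsCyclicPermOn f S) {b : α} (hb : b ∈ S) (k : ℕ) :
    (⇑f)^[k] b ∈ S := by
  by_contra h
  have h1 := hf.1 _ h
  have h2 : f b = b := by
    apply f.injective.iterate k
    rw [← Function.iterate_succ_apply, Function.iterate_succ_apply', h1]
  exact h (by rwa [Function.iterate_fixed h2])

theorem IsCyclicPermOn.minimalPeriod_eq_card [Fintype α] [DecidableEq α]
    (hf : IsCyclicPermOn f S) {b : α} (hb : b ∈ S) :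
    Function.minimalPeriod f b = S.card := by
  have himage : (Finset.range (Function.minimalPeriod f b)).image (fun i => (⇑f)^[i] b) = S := by
    ext c
    simp only [Finset.mem_image, Finset.mem_range]
    constructor
    · rintro ⟨i, -, rfl⟩
      exact hf.iterate_mem hb i
    · intro hc
      obtain ⟨k, rfl⟩ := hf.2 b hb c hc
      have hpos : 0 < Function.minimalPeriod f b :=
        Function.minimalPeriod_pos_of_mem_periodicPts
          (f.injective.mem_periodicPts b)
      exact ⟨k % _, Nat.mod_lt _ hpos, Function.iterate_mod_minimalPeriod_eq⟩
  conv_rhs => rw [← himage]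
  rw [Finset.card_image_of_injOn, Finset.card_range]
  intro i hi j hj hij
  exact Function.iterate_injOn_Iio_minimalPeriod (by simpa using hi) (by simpa using hj) hij

theorem IsCyclicPermOn.iterate_card [Fintype α] [DecidableEq α]
    (hf : IsCyclicPermOn f S) {b : α} (hb : b ∈ S) : (⇑f)^[S.card] b = b := by
  rw [← hf.minimalPeriod_eq_card hb]
  exact Function.iterate_minimalPeriod

theorem IsCyclicPermOn.iterate_inj [Fintype α] [DecidableEq α]
    (hf : IsCyclicPermOn f S) {b : α} (hb : b ∈ S) {i j : ℕ} (hi : i < S.card)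
    (hj : j < S.card) (hij : (⇑f)^[i] b = (⇑f)^[j] b) : i = j := by
  rw [← hf.minimalPeriod_eq_card hb] at hi hj
  exact Function.iterate_injOn_Iio_minimalPeriod hi hj hij

theorem IsCyclicPermOn.exists_iterate_lt_card [Fintype α] [DecidableEq α]
    (hf : IsCyclicPermOn f S) {b c : α} (hb : b ∈ S) (hc : c ∈ S) :
    ∃ i < S.card, (⇑f)^[i] b = c := by
  obtain ⟨k, rfl⟩ := hf.2 b hb c hc
  refine ⟨k % S.card, Nat.mod_lt _ (Finset.card_pos.2 ⟨b, hb⟩), ?_⟩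
  rw [← hf.minimalPeriod_eq_card hb]
  exact Function.iterate_mod_minimalPeriod_eq

theorem IsCyclicPermOn.cycOrd_swap_iff_not [Fintype α] [DecidableEq α]
    (hf : IsCyclicPermOn f S) {b c d : α} (hb : b ∈ S) (hc : c ∈ S) (hd : d ∈ S)
    (hbc : b ≠ c) (hbd : b ≠ d) (hcd : c ≠ d) :
    CycOrd f S b d c ↔ ¬ CycOrd f S b c d := by
  obtain ⟨i, hi, rfl⟩ := hf.exists_iterate_lt_card hb hc
  obtain ⟨j, hj, rfl⟩ := hf.exists_iterate_lt_card hb hd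
  have hi0 : i ≠ 0 := by rintro rfl; exact hbc rfl
  have hj0 : j ≠ 0 := by rintro rfl; exact hbd rfl
  have hij : i ≠ j := by rintro rfl; exact hcd rfl
  constructor
  · rintro ⟨j', i', hj0', hlt, hi', hje, hie⟩ ⟨i'', j'', hi0'', hlt', hj'', hie', hje'⟩
    have h1 := hf.iterate_inj hb (hlt.trans hi') hj hje
    have h2 := hf.iterate_inj hb hi' hi hie
    have h3 := hf.iterate_inj hb (hlt'.trans hj'') hi hie'
    have h4 := hf.iterate_inj hb hj'' hj hje'
    omega
  · intro h
    have hlt : ¬ i < j := fun hlt => h ⟨i, j, by omega, hlt, hj, rfl, rfl⟩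
    exact ⟨j, i, by omega, by omega, hi, rfl, rfl⟩

theorem IsCyclicPermOn.inv_iterate_card_sub [Fintype α] [DecidableEq α]
    (hf : IsCyclicPermOn f S) {b : α} (hb : b ∈ S) {i : ℕ} (hi : i ≤ S.card) :
    (⇑f⁻¹)^[S.card - i] b = (⇑f)^[i] b := by
  have hinv : Function.LeftInverse (⇑f⁻¹) f := fun x => by simp
  have h := hinv.iterate (S.card - i) ((⇑f)^[i] b)
  rwa [← Function.iterate_add_apply, Nat.sub_add_cancel hi, hf.iterate_card hb] at h

theorem IsCyclicPermOn.inv [Fintype α] [DecidableEq α] (hf : IsCyclicPermOn f S) :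
    IsCyclicPermOn f⁻¹ S := by
  refine ⟨fun a ha => Equiv.Perm.inv_eq_iff_eq.2 (hf.1 a ha).symm, fun a ha b hb => ?_⟩
  obtain ⟨i, hi, rfl⟩ := hf.exists_iterate_lt_card ha hb
  exact ⟨_, hf.inv_iterate_card_sub ha hi.le⟩

theorem IsCyclicPermOn.cycOrd_inv_of_cycOrd [Fintype α] [DecidableEq α]
    (hf : IsCyclicPermOn f S) {b c d : α} (hb : b ∈ S) (h : CycOrd f S b c d) :
    CycOrd f⁻¹ S b d c := by
  obtain ⟨i, j, hi, hij, hj, rfl, rfl⟩ := h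
  exact ⟨S.card - j, S.card - i, by omega, by omega, by omega,
    hf.inv_iterate_card_sub hb hj.le, hf.inv_iterate_card_sub hb (hij.trans hj).le⟩

theorem IsCyclicPermOn.eq_of_cycOrd_imp [Fintype α] [DecidableEq α]
    (hf : IsCyclicPermOn f S) (hg : IsCyclicPermOn g S)
    (h : ∀ b ∈ S, ∀ c d, CycOrd g S b c d → CycOrd f S b c d) : g = f := by
  ext b
  by_cases hb : b ∈ S
  swap
  · rw [hf.1 b hb, hg.1 b hb]
  by_contra hne
  obtain ⟨j, hj, hje⟩ := hg.exists_iterate_lt_card hb (hf.iterate_mem hb 1)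
  have hj1 : j ≠ 1 := by rintro rfl; exact hne hje
  have hj0 : j ≠ 0 := by
    rintro rfl
    have hfb : f b = b := hje.symm
    obtain ⟨k, hk⟩ := hf.2 b hb _ (hg.iterate_mem hb 1)
    rw [Function.iterate_fixed hfb] at hk
    exact hne (hk.symm.trans hfb.symm)
  obtain ⟨k, l, hk, hkl, hl, -, hle⟩ := h b hb _ _ ⟨1, j, one_pos, by omega, hj, rfl, hje⟩
  have := hf.iterate_inj hb hl (by omega) hle
  omega

end CyclicPerm

section PreRotSys

variable {α : Type*} [Fintype α] [DecidableEq α] {P P' : PreRotSys α}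

theorem not_restrictReflEq_of_restrictEq {I J : Finset α} (hIJ : 4 ≤ (I ∩ J).card)
    (hI : RestrictEq P P' I) : ¬ RestrictReflEq P P' J := by
  intro hJ
  obtain ⟨v, hv⟩ : (I ∩ J).Nonempty := Finset.card_pos.1 (by omega)
  have h3 : 2 < ((I ∩ J).erase v).card := by rw [Finset.card_erase_of_mem hv]; omega
  obtain ⟨b, hb, c, hc, d, hd, hbc, hbd, hcd⟩ := Finset.two_lt_card.1 h3
  simp only [Finset.mem_erase, Finset.mem_inter] at hv hb hc hd
  have h1 := hI v hv.1 b hb.2.1 c hc.2.1 d hd.2.1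
  have h2 := hJ v hv.2 b hb.2.2 c hc.2.2 d hd.2.2
  have h4 := (P.cyc v).cycOrd_swap_iff_not (b := b) (c := c) (d := d) (by simp [hb.1])
    (by simp [hc.1]) (by simp [hd.1]) hbc hbd hcd
  unfold rotOrd at h1 h2
  tauto

theorem restrictEq_of_restrictEq
    (h : ∀ I : Finset α, I.card = 5 → RestrictEq P P' I ∨ RestrictReflEq P P' I)
    {I J : Finset α} (hI : I.card = 5) (hJ : J.card = 5) (hE : RestrictEq P P' I) :
    RestrictEq P P' J := by
  induction hn : (I \ J).card generalizing I with
  | zero =>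
    have hsub : I ⊆ J := by rwa [Finset.card_eq_zero, Finset.sdiff_eq_empty_iff_subset] at hn
    rwa [← Finset.eq_of_subset_of_card_le hsub (by omega)]
  | succ n ih =>
    obtain ⟨x, hx⟩ : (I \ J).Nonempty := Finset.card_pos.1 (by omega)
    have hcomm : (I \ J).card = (J \ I).card := Finset.card_sdiff_comm (by omega)
    obtain ⟨y, hy⟩ : (J \ I).Nonempty := Finset.card_pos.1 (by omega)
    have hx' := Finset.mem_sdiff.1 hx
    have hy' := Finset.mem_sdiff.1 hy
    have hcard : (I.erase x).card = 4 := by rw [Finset.card_erase_of_mem hx'.1]; omega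
    have hcard' : (insert y (I.erase x)).card = 5 := by
      rw [Finset.card_insert_of_notMem (by simp [hy'.2]), hcard]
    have hinter : 4 ≤ (I ∩ insert y (I.erase x)).card := by
      rw [← hcard]
      exact Finset.card_le_card
        (Finset.subset_inter (Finset.erase_subset _ _) (Finset.subset_insert _ _))
    refine ih hcard' ((h _ hcard').resolve_right
      (not_restrictReflEq_of_restrictEq hinter hE)) ?_
    have : insert y (I.erase x) \ J = (I \ J).erase x := by
      ext z
      simp only [Finset.mem_sdiff, Finset.mem_insert, Finset.mem_erase]
      constructor
      · rintro ⟨rfl | hz, hzJ⟩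
        · exact absurd hy'.1 hzJ
        · exact ⟨hz.1, hz.2, hzJ⟩
      · rintro ⟨hz, hzI, hzJ⟩
        exact ⟨Or.inr ⟨hz, hzI⟩, hzJ⟩
    rw [this, Finset.card_erase_of_mem hx]
    omega

theorem exists_card_eq_five_superset (hcard : 5 ≤ Fintype.card α) (v b c d : α) :
    ∃ I : Finset α, I.card = 5 ∧ v ∈ I ∧ b ∈ I ∧ c ∈ I ∧ d ∈ I := by
  obtain ⟨I, hsub, hI⟩ := Finset.exists_superset_card_eq (s := {v, b, c, d}) (n := 5)
    (Finset.card_le_four.trans (by norm_num)) hcard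
  exact ⟨I, hI, hsub (by simp), hsub (by simp), hsub (by simp), hsub (by simp)⟩

end PreRotSys

/-- If two pre-rotation systems on a set of at least 5 elements are neither
equal nor reflections of each other, then they already differ (in the same sense) on some
induced subconfiguration on a 5-element subset. -/
theorem differ_on_five_element_subset
    {α : Type*} [Fintype α] [DecidableEq α] (hcard : 5 ≤ Fintype.card α)
    (P P' : PreRotSys α)
    (hne : ¬ ∀ v, P'.rot v = P.rot v) (hnr : ¬ IsReflection P P') :
    ∃ I : Finset α, I.card = 5 ∧ ¬ RestrictEq P P' I ∧ ¬ RestrictReflEq P P' I := by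
  by_contra! hcon
  have h : ∀ I : Finset α, I.card = 5 → RestrictEq P P' I ∨ RestrictReflEq P P' I :=
    fun I hI => or_iff_not_imp_left.2 (hcon I hI)
  by_cases hE : ∃ I : Finset α, I.card = 5 ∧ RestrictEq P P' I
  · obtain ⟨I, hI, hE⟩ := hE
    refine hne fun v => (P.cyc v).eq_of_cycOrd_imp (P'.cyc v) fun b _ c d hbcd => ?_
    obtain ⟨J, hJ, hvJ, hbJ, hcJ, hdJ⟩ := exists_card_eq_five_superset hcard v b c d
    exact (restrictEq_of_restrictEq h hI hJ hE v hvJ b hbJ c hcJ d hdJ).2 hbcd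
  · push Not at hE
    refine hnr fun v => (P.cyc v).inv.eq_of_cycOrd_imp (P'.cyc v) fun b hb c d hbcd => ?_
    obtain ⟨J, hJ, hvJ, hbJ, hcJ, hdJ⟩ := exists_card_eq_five_superset hcard v b c d
    exact (P.cyc v).cycOrd_inv_of_cycOrd hb
      ((hcon J hJ (hE J hJ) v hvJ b hbJ c hcJ d hdJ).1 hbcd)
end
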